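/- arXiv:1609.03436 — 2 statements merged into one kernel-verified Lean document; each statement's English description precedes it below -/
import Mathlib

section
/- Let d ≥ 1, let ν : ℝ^d → ℝ be twice continuously differentiable and strictly positive, let γ > 0 and η ∈ ℝ, and let V(x) = ν(x)^{-γ}. Then for every x ∈ ℝ^d, the generator applied to V^η satisfies 𝔄(V^η)(x) = (ηγ/2) · ν(x)^{-γη-2} · (ηγ‖∇ν(x)‖² − ν(x)·Δν(x)). -/
/-- The `i`-th partial derivative of `f : ℝ^d → ℝ` at `x`. -/
noncomputable def pd {d : ℕ} (f : EuclideanSpace ℝ (Fin d) → ℝ)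
    (x : EuclideanSpace ℝ (Fin d)) (i : Fin d) : ℝ :=
  fderiv ℝ f x (EuclideanSpace.single i 1)

/-- The Laplacian `Δf(x) = ∑ i, ∂²f/∂x_i²(x)`. -/
noncomputable def laplacian {d : ℕ} (f : EuclideanSpace ℝ (Fin d) → ℝ)
    (x : EuclideanSpace ℝ (Fin d)) : ℝ :=
  ∑ i, pd (fun y => pd f y i) x i

/-- The generator of the Langevin diffusion with invariant density `ν`:
`𝔄f(x) = (1/2)Δf(x) + (1/2)∇(log ν)(x)·∇f(x)`. -/
noncomputable def generator {d : ℕ} (ν f : EuclideanSpace ℝ (Fin d) → ℝ)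
    (x : EuclideanSpace ℝ (Fin d)) : ℝ :=
  (1 / 2) * laplacian f x +
    (1 / 2) * ∑ i, pd (fun y => Real.log (ν y)) x i * pd f x i

theorem pd_rpow_aux {d : ℕ} (ν : EuclideanSpace ℝ (Fin d) → ℝ)
    (hν : Differentiable ℝ ν) (hpos : ∀ x, 0 < ν x) (p : ℝ)
    (x : EuclideanSpace ℝ (Fin d)) (i : Fin d) :
    pd (fun y => ν y ^ p) x i = p * ν x ^ (p - 1) * pd ν x i := by
  have h := (hν x).hasFDerivAt.rpow_const (p := p) (Or.inl (hpos x).ne')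
  unfold pd
  rw [h.fderiv]
  simp

theorem pd_log_aux {d : ℕ} (ν : EuclideanSpace ℝ (Fin d) → ℝ)
    (hν : Differentiable ℝ ν) (hpos : ∀ x, 0 < ν x)
    (x : EuclideanSpace ℝ (Fin d)) (i : Fin d) :
    pd (fun y => Real.log (ν y)) x i = (ν x)⁻¹ * pd ν x i := by
  have h := (hν x).hasFDerivAt.log (hpos x).ne'
  unfold pd
  rw [h.fderiv]
  simp

theorem pd_mul_aux {d : ℕ} (f g : EuclideanSpace ℝ (Fin d) → ℝ)
    (x : EuclideanSpace ℝ (Fin d)) (hf : DifferentiableAt ℝ f x) (hg : DifferentiableAt ℝ g x)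
    (c : ℝ) (i : Fin d) :
    pd (fun y => c * f y * g y) x i = c * (pd f x i * g x + f x * pd g x i) := by
  have h : HasFDerivAt (fun y => c * f y * g y) _ x :=
    (hf.hasFDerivAt.const_mul c).mul hg.hasFDerivAt
  unfold pd
  rw [HasFDerivAt.fderiv h]
  simp
  ring


/-- For `V = ν^{-γ}`, the generator applied to `V^η = ν^{-γη}` satisfies
`𝔄(V^η)(x) = (ηγ/2)·ν(x)^{-γη-2}·(ηγ‖∇ν(x)‖² − ν(x)·Δν(x))`. -/
theorem generator_of_drift_function_pow
    (d : ℕ) (hd : 1 ≤ d) (ν : EuclideanSpace ℝ (Fin d) → ℝ)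
    (hν : ContDiff ℝ 2 ν) (hpos : ∀ x, 0 < ν x)
    (γ : ℝ) (hγ : 0 < γ) (η : ℝ) (x : EuclideanSpace ℝ (Fin d)) :
    generator ν (fun y => ν y ^ (-(γ * η))) x =
      (η * γ / 2) * ν x ^ (-(γ * η) - 2) *
        (η * γ * ∑ i, (pd ν x i) ^ 2 - ν x * laplacian ν x) := by
  have hd1 : Differentiable ℝ ν := hν.differentiable (by norm_num)
  have hd2 : ∀ i, Differentiable ℝ (fun y => pd ν y i) := by
    intro i
    have h1 : ContDiff ℝ 1 (fderiv ℝ ν) := hν.fderiv_right (by norm_num)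
    exact (h1.differentiable (by norm_num)).clm_apply (differentiable_const _)
  have hx := hpos x
  generalize hp : -(γ * η) = p
  have hp' : η * γ = -p := by rw [← hp]; ring
  have e1 : ν x ^ (p - 1) = ν x ^ (p - 2) * ν x := by
    rw [← Real.rpow_add_one hx.ne']; congr 1; ring
  have key : ∀ i, pd (fun y => pd (fun y => ν y ^ p) y i) x i =
      p * ((p - 1) * ν x ^ (p - 2) * pd ν x i * pd ν x i
        + ν x ^ (p - 1) * pd (fun y => pd ν y i) x i) := by
    intro i
    have : (fun y => pd (fun y => ν y ^ p) y i) = fun y => p * ν y ^ (p - 1) * pd ν y i :=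
      funext fun y => pd_rpow_aux ν hd1 hpos p y i
    rw [this, pd_mul_aux (fun y => ν y ^ (p - 1)) (fun y => pd ν y i) x
      ((hd1 x).rpow_const (Or.inl hx.ne')) (hd2 i x), pd_rpow_aux ν hd1 hpos,
      show p - 1 - 1 = p - 2 by ring]
  unfold generator laplacian
  simp only [key]
  simp only [pd_log_aux ν hd1 hpos, pd_rpow_aux ν hd1 hpos, hp', e1]
  simp only [Finset.mul_sum, ← Finset.sum_add_distrib, ← Finset.sum_sub_distrib]
  refine Finset.sum_congr rfl fun i _ => ?_
  field_simp
  ring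
end

section
/- Let d ≥ 1, let ν : ℝ^d → ℝ be twice continuously differentiable and strictly positive, let γ ≥ 1/2, set α = 1 − 1/(2γ), and let η satisfy α ≤ η ≤ 1 and η > 0. Suppose there exist δ > 0 and R ≥ 0 such that for every x ∈ ℝ^d with ‖x‖ ≥ R, Δν(x)/ν(x)^{γ+1/2} − γ‖∇ν(x)‖²/ν(x)^{γ+3/2} ≥ δ. Then, with c_η = ηγδ/2 > 0, for every x with ‖x‖ ≥ R one has 𝔄(V^η)(x) ≤ −c_η · V(x)^{η−α}. -/
theorem pd_rpow {d : ℕ} (ν : EuclideanSpace ℝ (Fin d) → ℝ) (p : ℝ)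
    (x : EuclideanSpace ℝ (Fin d)) (hd : DifferentiableAt ℝ ν x) (hpos : 0 < ν x) (i : Fin d) :
    pd (fun y => ν y ^ p) x i = p * ν x ^ (p - 1) * pd ν x i := by
  unfold pd
  rw [(hd.hasFDerivAt.rpow_const (p := p) (Or.inl hpos.ne')).fderiv]
  simp

theorem pd_log {d : ℕ} (ν : EuclideanSpace ℝ (Fin d) → ℝ)
    (x : EuclideanSpace ℝ (Fin d)) (hd : DifferentiableAt ℝ ν x) (hpos : 0 < ν x) (i : Fin d) :
    pd (fun y => Real.log (ν y)) x i = (ν x)⁻¹ * pd ν x i := by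
  unfold pd
  rw [(hd.hasFDerivAt.log hpos.ne').fderiv]
  simp

theorem pd_mul {d : ℕ} (f g : EuclideanSpace ℝ (Fin d) → ℝ)
    (x : EuclideanSpace ℝ (Fin d)) (hf : DifferentiableAt ℝ f x) (hg : DifferentiableAt ℝ g x)
    (i : Fin d) :
    pd (fun y => f y * g y) x i = f x * pd g x i + g x * pd f x i := by
  unfold pd
  rw [show (fun y => f y * g y) = f * g from rfl, (hf.hasFDerivAt.mul hg.hasFDerivAt).fderiv]
  simp

theorem generator_rpow {d : ℕ} (ν : EuclideanSpace ℝ (Fin d) → ℝ)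
    (hν : ContDiff ℝ 2 ν) (hpos : ∀ x, 0 < ν x) (p : ℝ) (x : EuclideanSpace ℝ (Fin d)) :
    generator ν (fun y => ν y ^ p) x =
      (p / 2) * ν x ^ (p - 1) * (laplacian ν x + p * (∑ i, (pd ν x i) ^ 2) / ν x) := by
  have hd : Differentiable ℝ ν := hν.differentiable (by norm_num)
  have hd2 : ∀ i, Differentiable ℝ (fun y => pd ν y i) := by
    intro i
    have h1 : ContDiff ℝ 1 (fderiv ℝ ν) := hν.fderiv_right (by norm_num)
    exact (h1.differentiable (by norm_num)).clm_apply (differentiable_const _)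
  have e2 : ν x ^ (p - 1 - 1) = ν x ^ (p - 1) / ν x := Real.rpow_sub_one (hpos x).ne' _
  have key : ∀ i, pd (fun y => pd (fun y => ν y ^ p) y i) x i =
      p * ν x ^ (p - 1) * pd (fun y => pd ν y i) x i
        + p * (p - 1) * (ν x ^ (p - 1) / ν x) * (pd ν x i) ^ 2 := by
    intro i
    have : (fun y => pd (fun y => ν y ^ p) y i) =
        fun y => ν y ^ (p - 1) * (p * pd ν y i) := by
      funext y
      rw [pd_rpow ν p y (hd y) (hpos y)]; ring
    have hc : pd (fun y => p * pd ν y i) x i = p * pd (fun y => pd ν y i) x i := by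
      rw [pd_mul (fun _ => p) _ x (differentiableAt_const _) (hd2 i x)]
      simp [pd]
    rw [this, pd_mul _ _ x ((hd x).rpow_const (Or.inl (hpos x).ne')) ((hd2 i x).const_mul p),
      hc, pd_rpow ν (p - 1) x (hd x) (hpos x), e2]
    ring
  have key2 : ∀ i, pd (fun y => Real.log (ν y)) x i * pd (fun y => ν y ^ p) x i =
      p * (ν x ^ (p - 1) / ν x) * (pd ν x i) ^ 2 := by
    intro i
    rw [pd_log ν x (hd x) (hpos x), pd_rpow ν p x (hd x) (hpos x)]
    ring
  unfold generator laplacian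
  simp only [key, key2, Finset.sum_add_distrib, ← Finset.mul_sum]
  ring

/-- Drift condition: if the tail condition (Q1) holds quantitatively outside the ball of
radius `R` (with margin `δ > 0`), then for `V = ν^{-γ}`, `α = 1 − 1/(2γ)`, `α ≤ η ≤ 1`,
`η > 0`, and `c_η = ηγδ/2 > 0`, one has `𝔄(V^η)(x) ≤ −c_η·V(x)^{η−α}` whenever `‖x‖ ≥ R`. -/
theorem drift_condition_of_tail_condition
    (d : ℕ) (hd : 1 ≤ d) (ν : EuclideanSpace ℝ (Fin d) → ℝ)
    (hν : ContDiff ℝ 2 ν) (hpos : ∀ x, 0 < ν x)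
    (γ α η δ R cη : ℝ)
    (hγ : 1 / 2 ≤ γ) (hα : α = 1 - 1 / (2 * γ))
    (hαη : α ≤ η) (hη1 : η ≤ 1) (hη0 : 0 < η)
    (hδ : 0 < δ) (hR : 0 ≤ R)
    (hQ : ∀ x : EuclideanSpace ℝ (Fin d), R ≤ ‖x‖ →
      δ ≤ laplacian ν x / ν x ^ (γ + 1 / 2)
            - γ * (∑ i, (pd ν x i) ^ 2) / ν x ^ (γ + 3 / 2))
    (hc : cη = η * γ * δ / 2) :
    0 < cη ∧
      ∀ x : EuclideanSpace ℝ (Fin d), R ≤ ‖x‖ →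
        generator ν (fun y => ν y ^ (-(γ * η))) x ≤ -cη * ν x ^ (-(γ * (η - α))) := by
  have hγ0 : 0 < γ := by linarith
  refine ⟨by rw [hc]; positivity, fun x hx => ?_⟩
  have hp := hpos x
  rw [generator_rpow ν hν hpos]
  have h := hQ x hx
  set L := laplacian ν x
  have hS : 0 ≤ ∑ i, (pd ν x i) ^ 2 := Finset.sum_nonneg fun i _ => sq_nonneg _
  set S := ∑ i, (pd ν x i) ^ 2
  have e1 : ν x ^ (γ + 3 / 2) = ν x ^ (γ + 1 / 2) * ν x := by
    rw [← Real.rpow_add_one hp.ne']; congr 1; ring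
  have e2 : ν x ^ (-(γ * (η - α))) = ν x ^ (-(γ * η) - 1) * ν x ^ (γ + 1 / 2) := by
    rw [← Real.rpow_add hp]; congr 1; rw [hα]; field_simp; ring
  have hA : 0 < ν x ^ (γ + 1 / 2) := Real.rpow_pos_of_pos hp _
  have hB : 0 < ν x ^ (-(γ * η) - 1) := Real.rpow_pos_of_pos hp _
  rw [e1] at h
  rw [e2, hc]
  set A := ν x ^ (γ + 1 / 2)
  set B := ν x ^ (-(γ * η) - 1)
  have h1 : δ * A ≤ L - γ * (S / ν x) := by
    have := mul_le_mul_of_nonneg_right h hA.le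
    have e : (L / A - γ * S / (A * ν x)) * A = L - γ * (S / ν x) := by field_simp
    linarith
  have hT : 0 ≤ γ * (S / ν x) := by positivity
  have h2 : δ * A ≤ L - γ * η * (S / ν x) := by nlinarith
  have h3 := mul_le_mul_of_nonneg_left h2 (show 0 ≤ γ * η / 2 * B by positivity)
  have e3 : -(γ * η) / 2 * B * (L + -(γ * η) * S / ν x)
      = -(γ * η / 2 * B * (L - γ * η * (S / ν x))) := by ring
  rw [e3]
  linarith
end
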